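/- Let n ≥ 1. There exists a constant C > 0, depending only on n, such that for every random n×n real matrix M which is almost surely symmetric and positive semidefinite and every ε ∈ (0,1], one has P( inf_{|η|=1} ⟨η, Mη⟩ ≤ ε ) ≤ C ε^{2−2n} sup_{|η|=1} P( ⟨η, Mη⟩ ≤ 4ε ) + P( ‖M‖ ≥ 1/ε ), where the infimum and supremum are over unit vectors η ∈ ℝⁿ. -/

import Mathlib

open MeasureTheory
open scoped RealInnerProductSpace

/-- The unit sphere of `ℝⁿ` has an `r`-net, made of points of the sphere, with at most
`((2n + 3) / r)ⁿ` elements. -/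
theorem exists_finset_net_unit_sphere (n : ℕ) (hn : 1 ≤ n) (r : ℝ) (hr : 0 < r) (hr1 : r ≤ 1) :
    ∃ s : Finset {η : EuclideanSpace ℝ (Fin n) // ‖η‖ = 1},
      (s.card : ℝ) ≤ ((2 * n + 3) / r) ^ n ∧
        ∀ x : {η : EuclideanSpace ℝ (Fin n) // ‖η‖ = 1},
          ∃ y ∈ s, ‖(x - y : EuclideanSpace ℝ (Fin n))‖ ≤ r := by
  classical
  have hn0 : (1 : ℝ) ≤ n := by exact_mod_cast hn
  have : Nonempty {η : EuclideanSpace ℝ (Fin n) // ‖η‖ = 1} :=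
    ⟨⟨EuclideanSpace.single ⟨0, hn⟩ 1, by simp⟩⟩
  set k : ℝ := n / r with hk
  have hkpos : 0 < k := by positivity
  let f : {η : EuclideanSpace ℝ (Fin n) // ‖η‖ = 1} → Fin n → ℤ := fun x i => ⌊x.1 i * k⌋
  let T : Finset (Fin n → ℤ) := Fintype.piFinset fun _ => Finset.Icc (-⌈k⌉) ⌈k⌉
  have hfT : ∀ x, f x ∈ T := by
    intro x
    refine Fintype.mem_piFinset.2 fun i => Finset.mem_Icc.2 ?_
    have hx : |x.1 i| ≤ 1 := by
      have := PiLp.norm_apply_le x.1 i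
      rwa [x.2, Real.norm_eq_abs] at this
    have hx' := abs_le.1 hx
    have hc := Int.le_ceil k
    constructor
    · refine Int.le_floor.2 ?_
      push_cast
      nlinarith
    · have h1 : (⌊x.1 i * k⌋ : ℝ) ≤ ⌈k⌉ := (Int.floor_le _).trans (by nlinarith)
      exact_mod_cast h1
  refine ⟨T.image (Function.invFun f), ?_, fun x => ⟨Function.invFun f (f x),
    Finset.mem_image_of_mem _ (hfT x), ?_⟩⟩
  · have hcard : (T.card : ℝ) = (2 * ⌈k⌉ + 1) ^ n := by
      have h0 : (0 : ℤ) ≤ ⌈k⌉ + 1 - -⌈k⌉ := by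
        have := Int.ceil_pos.2 hkpos
        omega
      have h1 : (((⌈k⌉ + 1 - -⌈k⌉).toNat : ℤ) : ℝ) = 2 * ⌈k⌉ + 1 := by
        rw [Int.toNat_of_nonneg h0]
        push_cast
        ring
      simp only [T, Fintype.card_piFinset, Int.card_Icc, Finset.prod_const, Finset.card_univ,
        Fintype.card_fin, Nat.cast_pow]
      rw [← h1, Int.cast_natCast]
    calc ((T.image (Function.invFun f)).card : ℝ) ≤ T.card := by
          exact_mod_cast Finset.card_image_le
      _ = (2 * ⌈k⌉ + 1) ^ n := hcard
      _ ≤ ((2 * n + 3) / r) ^ n := by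
          have hc := (Int.ceil_lt_add_one k).le
          have hc0 : (0 : ℝ) ≤ ⌈k⌉ := hkpos.le.trans (Int.le_ceil k)
          have h3 : 3 ≤ 3 / r := by rw [le_div_iff₀ hr]; linarith
          have h4 : (2 * n + 3) / r = 2 * k + 3 / r := by rw [hk]; ring
          refine pow_le_pow_left₀ (by positivity) ?_ n
          linarith
  · have hy : f (Function.invFun f (f x)) = f x := Function.invFun_eq ⟨x, rfl⟩
    set y := Function.invFun f (f x)
    refine abs_le_of_sq_le_sq' ?_ hr.le |>.2
    rw [EuclideanSpace.real_norm_sq_eq]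
    have hi : ∀ i, (x.1 - y.1) i ^ 2 ≤ (r / n) ^ 2 := by
      intro i
      have h1 := Int.abs_sub_lt_one_of_floor_eq_floor (congrFun hy i).symm
      rw [← sub_mul, abs_mul, abs_of_pos hkpos, ← lt_div_iff₀ hkpos, hk, one_div_div] at h1
      exact sq_le_sq' (abs_le.1 h1.le).1 (abs_le.1 h1.le).2
    calc ∑ i, (x.1 - y.1) i ^ 2 ≤ ∑ _i : Fin n, (r / n) ^ 2 := Finset.sum_le_sum fun i _ => hi i
      _ = r ^ 2 / n := by
          simp only [Finset.sum_const, Finset.card_univ, Fintype.card_fin, nsmul_eq_mul]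
          field_simp
      _ ≤ r ^ 2 := div_le_self (sq_nonneg r) hn0

/-- The unit sphere of `ℝⁿ` has an `ε`-net with `O(ε ^ (2 - 2n))` elements. -/
theorem exists_net_unit_sphere_card_le_rpow (n : ℕ) (hn : 1 ≤ n) :
    ∃ C : ℝ, 0 < C ∧ ∀ ε : ℝ, 0 < ε → ε ≤ 1 →
      ∃ s : Finset {η : EuclideanSpace ℝ (Fin n) // ‖η‖ = 1},
        (s.card : ℝ) ≤ C * ε ^ ((2 : ℝ) - 2 * n) ∧
          ∀ x : {η : EuclideanSpace ℝ (Fin n) // ‖η‖ = 1},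
            ∃ y ∈ s, ‖(x - y : EuclideanSpace ℝ (Fin n))‖ ≤ ε := by
  refine ⟨(2 * n + 3) ^ n, by positivity, fun ε hε hε1 => ?_⟩
  obtain rfl | h2 : n = 1 ∨ 2 ≤ n := by omega
  · obtain ⟨s, hs, hcov⟩ := exists_finset_net_unit_sphere 1 le_rfl 1 one_pos le_rfl
    refine ⟨s, by simpa using hs, fun x => ?_⟩
    obtain ⟨y, hy, hxy⟩ := hcov x
    refine ⟨y, hy, ?_⟩
    have hx2 := x.2
    have hy2 := y.2
    simp only [EuclideanSpace.norm_eq, Finset.univ_unique, Fin.default_eq_zero,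
      Finset.sum_singleton, Real.norm_eq_abs, sq_abs, Real.sqrt_sq_eq_abs, PiLp.sub_apply]
      at hx2 hy2 hxy ⊢
    rcases eq_or_eq_neg_of_abs_eq hx2 with h | h <;> rcases eq_or_eq_neg_of_abs_eq hy2 with h' | h'
    · simpa [h, h'] using hε.le
    · norm_num [h, h'] at hxy
    · norm_num [h, h'] at hxy
    · simpa [h, h'] using hε.le
  · obtain ⟨s, hs, hcov⟩ := exists_finset_net_unit_sphere n hn ε hε hε1
    refine ⟨s, hs.trans ?_, hcov⟩
    have h2' : (2 : ℝ) ≤ n := by exact_mod_cast h2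
    rw [div_pow, div_eq_mul_inv, ← Real.rpow_natCast ε n, ← Real.rpow_neg hε.le]
    gcongr ?_ * ?_
    exact Real.rpow_le_rpow_of_exponent_ge hε hε1 (by linarith)

/-- The form of a positive operator is quasi-subadditive. -/
theorem inner_apply_le_two_mul_add {E : Type*} [NormedAddCommGroup E] [InnerProductSpace ℝ E]
    (A : E →L[ℝ] E) (hA : ∀ x, 0 ≤ ⟪x, A x⟫) (x y : E) :
    ⟪y, A y⟫ ≤ 2 * ⟪x, A x⟫ + 2 * ⟪x - y, A (x - y)⟫ := by
  have h := hA (x - y + x)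
  simp only [map_add, map_sub, inner_add_left, inner_add_right, inner_sub_left,
    inner_sub_right] at h ⊢
  linarith

/-- A positive operator on a finite-dimensional space whose form has infimum at most `ε` on the
unit sphere, and whose norm is less than `1 / ε`, has form at most `4 * ε` at some point of any
`ε`-net of the sphere. -/
theorem exists_mem_net_inner_apply_le {E : Type*} [NormedAddCommGroup E] [InnerProductSpace ℝ E]
    [FiniteDimensional ℝ E] [Nontrivial E] (A : E →L[ℝ] E) (hA : ∀ x, 0 ≤ ⟪x, A x⟫)
    {ε : ℝ} (hε : 0 < ε) (hnorm : ‖A‖ < 1 / ε)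
    (hinf : (⨅ η : {η : E // ‖η‖ = 1}, ⟪(η : E), A η⟫) ≤ ε) (s : Finset {η : E // ‖η‖ = 1})
    (hs : ∀ x : {η : E // ‖η‖ = 1}, ∃ y ∈ s, ‖(x - y : E)‖ ≤ ε) :
    ∃ y ∈ s, ⟪(y : E), A y⟫ ≤ 4 * ε := by
  have hne : (Metric.sphere (0 : E) 1).Nonempty := NormedSpace.sphere_nonempty.2 zero_le_one
  obtain ⟨x, hx, hmin⟩ := (isCompact_sphere (0 : E) 1).exists_isMinOn (f := fun x => ⟪x, A x⟫) hne
    (by fun_prop)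
  have hx1 : ‖x‖ = 1 := by simpa using hx
  have : Nonempty {η : E // ‖η‖ = 1} := ⟨⟨x, hx1⟩⟩
  have hxε : ⟪x, A x⟫ ≤ ε := (le_ciInf fun η => hmin (by simpa using η.2)).trans hinf
  obtain ⟨y, hy, hxy⟩ := hs ⟨x, hx1⟩
  refine ⟨y, hy, (inner_apply_le_two_mul_add A hA x y).trans ?_⟩
  have h1 : ⟪x - y, A (x - y)⟫ ≤ ε := calc
    ⟪x - y, A (x - y)⟫ ≤ ‖x - y‖ * ‖A (x - y)‖ := real_inner_le_norm _ _
    _ ≤ ‖x - y‖ * (‖A‖ * ‖x - y‖) := by gcongr; exact A.le_opNorm _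
    _ ≤ ε * (1 / ε * ε) := by gcongr
    _ = ε := by field_simp
  linarith

/-- **Net estimate for the smallest quadratic form of a random PSD matrix.** There is a
constant `C = C(n) > 0` such that for every random a.s. symmetric positive semidefinite
`n×n` matrix `M` and every `ε ∈ (0,1]`,
`P(inf_{|η|=1} ⟨η,Mη⟩ ≤ ε) ≤ C ε^{2−2n} sup_{|η|=1} P(⟨η,Mη⟩ ≤ 4ε) + P(‖M‖ ≥ 1/ε)`. -/
theorem psd_matrix_net_estimate (n : ℕ) (hn : 1 ≤ n) :
    ∃ C : ℝ, 0 < C ∧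
      ∀ {Ω : Type} [MeasurableSpace Ω] (P : Measure Ω), IsProbabilityMeasure P →
      ∀ (M : Ω → Matrix (Fin n) (Fin n) ℝ), (∀ i j, Measurable fun ω => M ω i j) →
        (∀ᵐ ω ∂P, (M ω).PosSemidef) →
      ∀ ε : ℝ, 0 < ε → ε ≤ 1 →
        P {ω | (⨅ η : {η : EuclideanSpace ℝ (Fin n) // ‖η‖ = 1},
              ⟪(η : EuclideanSpace ℝ (Fin n)),
                Matrix.toEuclideanCLM (𝕜 := ℝ) (M ω) η⟫) ≤ ε}
          ≤ ENNReal.ofReal (C * ε ^ ((2 : ℝ) - 2 * n)) *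
              (⨆ η : {η : EuclideanSpace ℝ (Fin n) // ‖η‖ = 1},
                P {ω | ⟪(η : EuclideanSpace ℝ (Fin n)),
                    Matrix.toEuclideanCLM (𝕜 := ℝ) (M ω) η⟫ ≤ 4 * ε})
            + P {ω | 1 / ε ≤ ‖Matrix.toEuclideanCLM (𝕜 := ℝ) (M ω)‖} := by
  obtain ⟨C, hC, hnet⟩ := exists_net_unit_sphere_card_le_rpow n hn
  refine ⟨C, hC, fun {Ω} _ P _ M _ hM ε hε hε1 => ?_⟩
  obtain ⟨s, hcard, hs⟩ := hnet ε hε hε1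
  have : Nonempty (Fin n) := ⟨⟨0, hn⟩⟩
  set S : {η : EuclideanSpace ℝ (Fin n) // ‖η‖ = 1} → Set Ω := fun η =>
    {ω | ⟪(η : EuclideanSpace ℝ (Fin n)), Matrix.toEuclideanCLM (𝕜 := ℝ) (M ω) η⟫ ≤ 4 * ε}
  set B : Set Ω := {ω | 1 / ε ≤ ‖Matrix.toEuclideanCLM (𝕜 := ℝ) (M ω)‖}
  have hsub : P {ω | (⨅ η : {η : EuclideanSpace ℝ (Fin n) // ‖η‖ = 1},
      ⟪(η : EuclideanSpace ℝ (Fin n)), Matrix.toEuclideanCLM (𝕜 := ℝ) (M ω) η⟫) ≤ ε}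
      ≤ P ((⋃ η ∈ s, S η) ∪ B) := by
    refine measure_mono_ae ?_
    filter_upwards [hM] with ω hω hinf
    by_cases hB : 1 / ε ≤ ‖Matrix.toEuclideanCLM (𝕜 := ℝ) (M ω)‖
    · exact Or.inr hB
    · obtain ⟨y, hy, hyε⟩ := exists_mem_net_inner_apply_le (Matrix.toEuclideanCLM (𝕜 := ℝ) (M ω))
        (fun x => by
          rw [Matrix.inner_toEuclideanCLM]
          simpa using hω.dotProduct_mulVec_nonneg x.ofLp) hε (not_le.1 hB) hinf s hs
      exact Or.inl (Set.mem_biUnion hy hyε)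
  refine hsub.trans ((measure_union_le _ _).trans ?_)
  gcongr
  calc P (⋃ η ∈ s, S η) ≤ ∑ η ∈ s, P (S η) := measure_biUnion_finset_le s S
    _ ≤ ∑ _η ∈ s, ⨆ η, P (S η) := Finset.sum_le_sum fun η _ => le_iSup (fun η => P (S η)) η
    _ = s.card * ⨆ η, P (S η) := by rw [Finset.sum_const, nsmul_eq_mul]
    _ ≤ ENNReal.ofReal (C * ε ^ ((2 : ℝ) - 2 * n)) * ⨆ η, P (S η) := by
        gcongr
        rw [← ENNReal.ofReal_natCast]
        exact ENNReal.ofReal_le_ofReal hcard
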